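/- arXiv:0811.2675 — 10 statements merged into one kernel-verified Lean document; each statement's English description precedes it below -/
import Mathlib

section
/- Let G=(V,E) be a finite simple graph with an independent set N ⊆ V, and let A(G) be its augmented adjacency matrix. Then G is a probe interval graph with probes P = V∖N and nonprobes N if and only if there is a linear ordering of V such that A(G) satisfies the quasi-x-linear ones property with respect to N, i.e.: for every position (u,v) with u before v in the ordering, A(G)_{uv}=0 and not both u,v ∈ N, one has A(G)_{uw}=0 for every w after v; and for every position (u,v) with u after v in the ordering, A(G)_{uv}=0 and not both u,v ∈ N, one has A(G)_{wv}=0 for every w after u. -/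
/-- A finite simple graph is a probe interval graph with probes `P` and nonprobes `N`
if `V` is partitioned into `P` and `N` and each vertex can be assigned a nonempty
closed real interval such that two distinct vertices are adjacent iff their
intervals intersect and at least one of them is a probe. -/
def IsProbeIntervalGraph {V : Type*} (G : SimpleGraph V) (P N : Set V) : Prop :=
  P ∪ N = Set.univ ∧ P ∩ N = ∅ ∧
  ∃ a b : V → ℝ, (∀ v, a v ≤ b v) ∧
    ∀ u v : V, u ≠ v →
      (G.Adj u v ↔
        ((Set.Icc (a u) (b u) ∩ Set.Icc (a v) (b v)).Nonempty ∧ (u ∈ P ∨ v ∈ P)))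

/-- The augmented adjacency matrix of `G`: entry `(u,v)` is `1` iff `u = v` or
`u` and `v` are adjacent. -/
def AugAdj {V : Type*} (G : SimpleGraph V) (u v : V) : Prop :=
  u = v ∨ G.Adj u v

/-- The vertices of a finite type can be enumerated in nondecreasing order of a real function. -/
lemma exists_injective_nat_monotone {V : Type*} [Fintype V] (a : V → ℝ) :
    ∃ σ : V → ℕ, Function.Injective σ ∧ ∀ u v, σ u ≤ σ v → a u ≤ a v := by
  classical
  let e := Fintype.equivFin V
  let s := Tuple.sort (a ∘ e.symm)
  refine ⟨fun v => (s.symm (e v) : ℕ), fun u v h => ?_, fun u v h => ?_⟩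
  · exact e.injective (s.symm.injective (Fin.ext h))
  · have h' : s.symm (e u) ≤ s.symm (e v) := h
    simpa [s] using Tuple.monotone_sort (a ∘ e.symm) h'

/-- Two closed intervals, the first of which starts no later than the second, meet iff
the second starts before the first ends. -/
lemma Icc_inter_Icc_nonempty_iff_of_le {a b c d : ℝ} (hcd : c ≤ d) (hac : a ≤ c) :
    (Set.Icc a b ∩ Set.Icc c d).Nonempty ↔ c ≤ b := by
  constructor
  · rintro ⟨x, hx, hy⟩
    exact hy.1.trans hx.2
  · exact fun h => ⟨c, ⟨hac, h⟩, le_rfl, hcd⟩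

lemma augAdj_comm {V : Type*} {G : SimpleGraph V} {u v : V} : AugAdj G u v ↔ AugAdj G v u := by
  rw [AugAdj, AugAdj, eq_comm, G.adj_comm]

/-- `G` with independent set `N` is a probe interval graph with probes
`P = V ∖ N` and nonprobes `N` iff there is a linear ordering of `V` (given by an
injection `σ` into `ℕ`) with respect to which the augmented adjacency matrix of `G`
satisfies the quasi-x-linear ones property: every `0` entry right of the diagonal
which is not an `X` (i.e. not indexed by two nonprobes) has only `0`'s and `X`'s to
its right, and every such `0` below the diagonal has only `0`'s and `X`'s below it. -/
theorem probeIntervalGraph_iff_quasiXLinearOnes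
    {V : Type*} [Fintype V] (G : SimpleGraph V) (N : Set V)
    (hN : ∀ u ∈ N, ∀ v ∈ N, ¬ G.Adj u v) :
    IsProbeIntervalGraph G Nᶜ N ↔
      ∃ σ : V → ℕ, Function.Injective σ ∧
        (∀ u v : V, σ u < σ v → ¬ AugAdj G u v → ¬ (u ∈ N ∧ v ∈ N) →
          ∀ w : V, σ v < σ w → ¬ AugAdj G u w) ∧
        (∀ u v : V, σ v < σ u → ¬ AugAdj G u v → ¬ (u ∈ N ∧ v ∈ N) →
          ∀ w : V, σ u < σ w → ¬ AugAdj G w v) := by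
  classical
  constructor
  · rintro ⟨-, -, a, b, hab, hadj⟩
    obtain ⟨σ, hσ, hmono⟩ := exists_injective_nat_monotone a
    have key : ∀ u v : V, σ u < σ v → ¬ AugAdj G u v → ¬ (u ∈ N ∧ v ∈ N) →
        ∀ w : V, σ v < σ w → ¬ AugAdj G u w := by
      intro u v huv hnot hNN w hvw huw
      have huw_ne : u ≠ w := fun h => by subst h; omega
      have huv_ne : u ≠ v := fun h => by subst h; omega
      have hvw' := hmono v w hvw.le
      have huv' := hmono u v huv.le
      have hmeet := ((hadj u w huw_ne).1 (huw.resolve_left huw_ne)).1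
      rw [Icc_inter_Icc_nonempty_iff_of_le (hab w) (huv'.trans hvw')] at hmeet
      refine hnot (Or.inr ((hadj u v huv_ne).2 ⟨?_, not_and_or.1 hNN⟩))
      exact (Icc_inter_Icc_nonempty_iff_of_le (hab v) huv').2 (hvw'.trans hmeet)
    refine ⟨σ, hσ, key, fun u v hvu hnot hNN w huw hwv => ?_⟩
    exact key v u hvu (mt augAdj_comm.1 hnot) (mt And.symm hNN) w huw (augAdj_comm.1 hwv)
  · rintro ⟨σ, hσ, hright, -⟩
    let b : V → ℕ := fun v => (Finset.univ.filter (AugAdj G v)).sup σ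
    have hle : ∀ u v, AugAdj G u v → σ v ≤ b u := fun u v h =>
      Finset.le_sup (f := σ) (by simpa using h)
    have hb : ∀ v, (σ v : ℝ) ≤ b v := fun v => by exact_mod_cast hle v v (Or.inl rfl)
    have key : ∀ u v, σ u < σ v → (G.Adj u v ↔
        ((Set.Icc (σ u : ℝ) (b u) ∩ Set.Icc (σ v : ℝ) (b v)).Nonempty ∧
          (u ∈ Nᶜ ∨ v ∈ Nᶜ))) := by
      intro u v huv
      rw [Icc_inter_Icc_nonempty_iff_of_le (hb v) (by exact_mod_cast huv.le), Nat.cast_le]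
      refine ⟨fun h => ⟨hle u v (Or.inr h), not_and_or.1 fun hNN => hN u hNN.1 v hNN.2 h⟩, ?_⟩
      rintro ⟨hvb, hP⟩
      obtain ⟨w, hw, hvw⟩ := (Finset.le_sup_iff (by simp; omega)).1 hvb
      have huw : AugAdj G u w := by simpa using hw
      by_contra hnot
      have haug : ¬ AugAdj G u v := by
        rintro (rfl | h)
        · omega
        · exact hnot h
      rcases hvw.eq_or_lt with heq | hlt
      · exact haug (hσ heq ▸ huw)
      · exact hright u v huv haug (not_and_or.2 hP) w hlt huw
    refine ⟨Set.compl_union_self N, Set.compl_inter_self N,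
      fun v => σ v, fun v => b v, hb, fun u v huv => ?_⟩
    rcases lt_or_gt_of_ne (hσ.ne huv) with h | h
    · exact key u v h
    · rw [G.adj_comm, Set.inter_comm, or_comm]
      exact key v u h
end

section
/- Let n ≥ 1 and let M be an n×n matrix each of whose entries is one of the three symbols 1, R, C, such that: every diagonal entry is 1; M_{ij}=R implies i<j; M_{ij}=C implies i>j; if M_{ij}=R and j<k then M_{ik}=R; and if M_{ij}=C and i<k then M_{kj}=C. For each row i let b_i = max{ j : j ≥ i and M_{ij}=1 }, and for each column j let d_j = max{ i : i ≥ j and M_{ij}=1 } (these maxima exist since diagonal entries are 1). Then for all i,j: M_{ij}=1 if and only if the closed intervals [i, b_i] and [j, d_j] intersect. In particular these intervals give an interval representation of the bipartite graph whose biadjacency matrix has a 1 exactly where M does. -/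
/-- Entries of a diagonalized biadjacency matrix in R-C partition form:
`one` is a `1` entry, `R` and `C` are the two labels of zero entries. -/
inductive RCEntry : Type
  | one : RCEntry
  | R : RCEntry
  | C : RCEntry
  deriving DecidableEq

/-- Let `M` be an `n × n` matrix with entries in `{1, R, C}` such that the
diagonal is all `1`, each `R` is strictly above the diagonal, each `C` strictly below,
entries to the right of an `R` are `R` and entries below a `C` are `C`.  With
`b i = max { j ≥ i : M i j = 1 }` and `d j = max { i ≥ j : M i j = 1 }`, the entry
`M i j` is `1` iff the closed intervals `[i, b i]` and `[j, d j]` intersect; thus these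
intervals form an interval representation of the bigraph whose biadjacency matrix has
a `1` exactly where `M` does. -/
theorem diagonalized_matrix_interval_representation
    {n : ℕ} (hn : 1 ≤ n) (M : Fin n → Fin n → RCEntry)
    (hdiag : ∀ i : Fin n, M i i = RCEntry.one)
    (hR : ∀ i j : Fin n, M i j = RCEntry.R → i < j)
    (hC : ∀ i j : Fin n, M i j = RCEntry.C → j < i)
    (hRright : ∀ i j k : Fin n, M i j = RCEntry.R → j < k → M i k = RCEntry.R)
    (hCbelow : ∀ i j k : Fin n, M i j = RCEntry.C → i < k → M k j = RCEntry.C)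
    (b d : Fin n → Fin n)
    (hb : ∀ i : Fin n, i ≤ b i ∧ M i (b i) = RCEntry.one ∧
      ∀ j : Fin n, i ≤ j → M i j = RCEntry.one → j ≤ b i)
    (hd : ∀ j : Fin n, j ≤ d j ∧ M (d j) j = RCEntry.one ∧
      ∀ i : Fin n, j ≤ i → M i j = RCEntry.one → i ≤ d j) :
    ∀ i j : Fin n,
      M i j = RCEntry.one ↔
        (Set.Icc (i.val : ℝ) ((b i).val : ℝ) ∩
          Set.Icc (j.val : ℝ) ((d j).val : ℝ)).Nonempty := by
  intro i j
  obtain ⟨hib, hMb, hbmax⟩ := hb i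
  obtain ⟨hjd, hMd, hdmax⟩ := hd j
  rw [Set.Icc_inter_Icc, Set.nonempty_Icc, sup_le_iff, le_inf_iff, le_inf_iff]
  simp only [Nat.cast_le, Fin.val_fin_le]
  constructor
  · intro h
    exact ⟨⟨hib, (le_total j i).elim (fun hji => hdmax i hji h) fun hij => hij.trans hjd⟩,
      (le_total i j).elim (fun hij => hbmax j hij h) fun hji => hji.trans hib, hjd⟩
  · rintro ⟨⟨-, hid⟩, hjb, -⟩
    cases h : M i j with
    | one => rfl
    | R =>
      rcases hjb.eq_or_lt with heq | hlt
      · rw [heq, hMb] at h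
        cases h
      · cases hMb.symm.trans (hRright i j (b i) h hlt)
    | C =>
      rcases hid.eq_or_lt with heq | hlt
      · rw [heq, hMd] at h
        cases h
      · cases hMd.symm.trans (hCbelow i j (d j) h hlt)
end

section
/- Let A be an m×n (0,1)-matrix admitting an R-C partition, i.e., a labeling of its zero entries by the symbols R and C such that every entry to the right of an R in the same row is an R and every entry below a C in the same column is a C. Then there exists an (m+n)×(m+n) matrix Ã, each of whose entries is one of the symbols 1, R, C, together with order-preserving injections of the row indices of A into the row indices of à and of the column indices of A into the column indices of Ã, such that: the submatrix of à on the image rows and columns agrees with the labeled matrix A (1 entries to 1, R-labeled zeros to R, C-labeled zeros to C); all diagonal entries of à are 1; every R entry of à lies strictly above the diagonal and every C entry strictly below it; every entry to the right of an R in the same row of à is R; and every entry below a C in the same column of à is C. -/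
/-- A relation on `Fin m × Fin n` that is upward closed in the first and downward closed in the
second argument is realised by an interleaving of the two linear orders. -/
theorem exists_interleaving {m n : ℕ} (P : Fin m → Fin n → Prop)
    (hrow : ∀ i i' j, i ≤ i' → P i j → P i' j) (hcol : ∀ i j j', j' ≤ j → P i j → P i j') :
    ∃ (ρ : Fin m → Fin (m + n)) (γ : Fin n → Fin (m + n)), StrictMono ρ ∧ StrictMono γ ∧
      (∀ i j, P i j → γ j < ρ i) ∧ (∀ i j, ¬ P i j → ρ i < γ j) := by
  classical
  let c : Fin m → ℕ := fun i => (Finset.univ.filter fun j => P i j).card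
  let d : Fin n → ℕ := fun j => (Finset.univ.filter fun i => ¬ P i j).card
  have hc : ∀ i, c i ≤ n := fun i => (Finset.card_le_univ _).trans_eq (Fintype.card_fin n)
  have hd : ∀ j, d j ≤ m := fun j => (Finset.card_le_univ _).trans_eq (Fintype.card_fin m)
  have hc_mono : ∀ i i', i ≤ i' → c i ≤ c i' := fun i i' h =>
    Finset.card_le_card (Finset.monotone_filter_right _ fun j _ => hrow i i' j h)
  have hd_mono : ∀ j j', j ≤ j' → d j ≤ d j' := fun j j' h =>
    Finset.card_le_card (Finset.monotone_filter_right _ fun i _ => mt (hcol i j' j h))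
  refine ⟨fun i => ⟨i + c i, by have := hc i; omega⟩, fun j => ⟨j + d j, by have := hd j; omega⟩,
    fun i i' h => ?_, fun j j' h => ?_, fun i j h => ?_, fun i j h => ?_⟩ <;>
    rw [Fin.lt_def] <;> dsimp only
  · have := hc_mono i i' h.le
    omega
  · have := hd_mono j j' h.le
    omega
  · have h1 : (Finset.Iic j).card ≤ c i := Finset.card_le_card fun j' hj' => by
      simpa using hcol i j j' (Finset.mem_Iic.1 hj') h
    have h2 : d j ≤ (Finset.Iio i).card := Finset.card_le_card fun i' hi' => by
      simp only [Finset.mem_filter, Finset.mem_univ, true_and] at hi'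
      exact Finset.mem_Iio.2 (lt_of_not_ge fun hle => hi' (hrow i i' j hle h))
    rw [Fin.card_Iic] at h1
    rw [Fin.card_Iio] at h2
    omega
  · have h1 : (Finset.Iic i).card ≤ d j := Finset.card_le_card fun i' hi' => by
      simpa using fun hP => h (hrow i' i j (Finset.mem_Iic.1 hi') hP)
    have h2 : c i ≤ (Finset.Iio j).card := Finset.card_le_card fun j' hj' => by
      simp only [Finset.mem_filter, Finset.mem_univ, true_and] at hj'
      exact Finset.mem_Iio.2 (lt_of_not_ge fun hle => h (hcol i j' j hle hj'))
    rw [Fin.card_Iic] at h1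
    rw [Fin.card_Iio] at h2
    omega

/-- Every `m × n` (0,1)-matrix with an R-C partition (encoded as a matrix
`M` with entries in `{1, R, C}`, where every entry right of an `R` is `R` and every
entry below a `C` is `C`) admits a diagonalization: an `(m+n) × (m+n)` matrix `Ã`
with entries in `{1, R, C}` together with order-preserving injections of the rows and
columns of `M` into those of `Ã`, such that `Ã` restricted to the image rows and
columns agrees with `M`, all diagonal entries of `Ã` are `1`, every `R` of `Ã` lies
strictly above the diagonal and every `C` strictly below it, every entry right of an
`R` is `R`, and every entry below a `C` is `C`. -/
theorem exists_diagonalization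
    {m n : ℕ} (M : Fin m → Fin n → RCEntry)
    (hRright : ∀ (i : Fin m) (j k : Fin n), M i j = RCEntry.R → j < k → M i k = RCEntry.R)
    (hCbelow : ∀ (i k : Fin m) (j : Fin n), M i j = RCEntry.C → i < k → M k j = RCEntry.C) :
    ∃ (A : Fin (m + n) → Fin (m + n) → RCEntry)
      (ρ : Fin m → Fin (m + n)) (γ : Fin n → Fin (m + n)),
      StrictMono ρ ∧ StrictMono γ ∧
      (∀ (i : Fin m) (j : Fin n), A (ρ i) (γ j) = M i j) ∧
      (∀ k : Fin (m + n), A k k = RCEntry.one) ∧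
      (∀ k l : Fin (m + n), A k l = RCEntry.R → k < l) ∧
      (∀ k l : Fin (m + n), A k l = RCEntry.C → l < k) ∧
      (∀ k l l' : Fin (m + n), A k l = RCEntry.R → l < l' → A k l' = RCEntry.R) ∧
      (∀ k k' l : Fin (m + n), A k l = RCEntry.C → k < k' → A k' l = RCEntry.C) := by
  classical
  have hR_le : ∀ i j k, j ≤ k → M i j = RCEntry.R → M i k = RCEntry.R := fun i j k hjk h =>
    hjk.eq_or_lt.elim (fun e => e ▸ h) (hRright i j k h)
  have hC_le : ∀ i k j, i ≤ k → M i j = RCEntry.C → M k j = RCEntry.C := fun i k j hik h =>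
    hik.eq_or_lt.elim (fun e => e ▸ h) (hCbelow i k j h)
  obtain ⟨ρ, γ, hρ, hγ, hlt, hgt⟩ := exists_interleaving
    (fun i j => ∃ j', j ≤ j' ∧ M i j' = RCEntry.C)
    (fun i i' j h ⟨j', hj', hC⟩ => ⟨j', hj', hC_le i i' j' h hC⟩)
    (fun i j j' h ⟨k, hk, hC⟩ => ⟨k, h.trans hk, hC⟩)
  have hC_lt : ∀ i j, M i j = RCEntry.C → γ j < ρ i := fun i j h => hlt i j ⟨j, le_rfl, h⟩
  have hR_lt : ∀ i j, M i j = RCEntry.R → ρ i < γ j := fun i j h => hgt i j fun ⟨j', hj', hC⟩ => by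
    simp [hR_le i j j' hj' h] at hC
  let isR : Fin (m + n) → Fin (m + n) → Prop := fun k l =>
    ∃ i j, k = ρ i ∧ γ j ≤ l ∧ M i j = RCEntry.R
  let isC : Fin (m + n) → Fin (m + n) → Prop := fun k l =>
    ∃ i j, l = γ j ∧ ρ i ≤ k ∧ M i j = RCEntry.C
  have isR_lt : ∀ k l, isR k l → k < l := by
    rintro k l ⟨i, j, rfl, hl, h⟩
    exact (hR_lt i j h).trans_le hl
  have isC_lt : ∀ k l, isC k l → l < k := by
    rintro k l ⟨i, j, rfl, hk, h⟩
    exact (hC_lt i j h).trans_le hk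
  have isR_iff : ∀ i j, isR (ρ i) (γ j) ↔ M i j = RCEntry.R := by
    refine fun i j => ⟨?_, fun h => ⟨i, j, rfl, le_rfl, h⟩⟩
    rintro ⟨i', j', hi, hj, h⟩
    obtain rfl := hρ.injective hi
    exact hR_le i j' j (hγ.le_iff_le.1 hj) h
  have isC_iff : ∀ i j, isC (ρ i) (γ j) ↔ M i j = RCEntry.C := by
    refine fun i j => ⟨?_, fun h => ⟨i, j, rfl, le_rfl, h⟩⟩
    rintro ⟨i', j', hj, hi, h⟩
    obtain rfl := hγ.injective hj
    exact hC_le i' i j (hρ.le_iff_le.1 hi) h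
  let A : Fin (m + n) → Fin (m + n) → RCEntry := fun k l =>
    if isR k l then RCEntry.R else if isC k l then RCEntry.C else RCEntry.one
  have A_R : ∀ k l, A k l = RCEntry.R ↔ isR k l := fun k l => by
    by_cases h : isR k l <;> by_cases h' : isC k l <;> simp [A, h, h']
  have A_C : ∀ k l, A k l = RCEntry.C ↔ isC k l := fun k l => by
    by_cases h : isR k l
    · have : ¬ isC k l := fun h' => lt_asymm (isR_lt k l h) (isC_lt k l h')
      simp [A, h, this]
    · by_cases h' : isC k l <;> simp [A, h, h']
  refine ⟨A, ρ, γ, hρ, hγ, fun i j => ?_, fun k => ?_, fun k l h => isR_lt k l ((A_R k l).1 h),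
    fun k l h => isC_lt k l ((A_C k l).1 h), fun k l l' h hl => ?_, fun k k' l h hk => ?_⟩
  · simp only [A, isR_iff, isC_iff]
    cases M i j <;> simp
  · have h : ¬ isR k k := fun h => (isR_lt k k h).false
    have h' : ¬ isC k k := fun h => (isC_lt k k h).false
    simp [A, h, h']
  · obtain ⟨i, j, hi, hj, hM⟩ := (A_R k l).1 h
    exact (A_R k l').2 ⟨i, j, hi, hj.trans hl.le, hM⟩
  · obtain ⟨i, j, hj, hi, hM⟩ := (A_C k l).1 h
    exact (A_C k' l).2 ⟨i, j, hj, hi.trans hk.le, hM⟩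
end

section
/- Let G=(V,E) be a probe interval graph with probes P and nonprobes N. Then the bipartite graph B=(P,V,E_1), with partite sets P and a disjoint copy of V, where p ∈ P is adjacent to v ∈ V if and only if p = v or pv ∈ E, is an interval bigraph. -/
/-- A bipartite graph, given by a relation `E : X → Y → Prop`, is an interval bigraph
if each vertex can be assigned a nonempty closed real interval such that `x ∈ X` and
`y ∈ Y` are adjacent iff their intervals intersect. -/
def IsIntervalBigraph {X Y : Type*} (E : X → Y → Prop) : Prop :=
  ∃ (a b : X → ℝ) (c d : Y → ℝ), (∀ x, a x ≤ b x) ∧ (∀ y, c y ≤ d y) ∧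
    ∀ (x : X) (y : Y),
      E x y ↔ (Set.Icc (a x) (b x) ∩ Set.Icc (c y) (d y)).Nonempty

/-- If `G` is a probe interval graph with probes `P` and nonprobes `N`,
then the bipartite graph `B = (P, V, E₁)`, where `p ∈ P` is adjacent to `v ∈ V` iff
`p = v` or `pv ∈ E`, is an interval bigraph. -/
theorem probeIntervalGraph_bigraph_isIntervalBigraph
    {V : Type*} [Fintype V] (G : SimpleGraph V) (P N : Set V)
    (h : IsProbeIntervalGraph G P N) :
    IsIntervalBigraph (fun (p : ↥P) (v : V) => (p : V) = v ∨ G.Adj (p : V) v) := by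
  obtain ⟨-, -, a, b, hab, hadj⟩ := h
  refine ⟨fun p => a p, fun p => b p, a, b, fun p => hab p, hab, fun p v => ?_⟩
  by_cases hpv : (p : V) = v
  · subst hpv
    simp [hab]
  · simp [hpv, hadj _ _ hpv]
end

section
/- Let G be the simple graph on vertex set {a,b,c,d,e,f} with edge set {ab, bc, bd, cd, ce, df}, let N = {e,f} and P = {a,b,c,d}. Then: (i) the bipartite graph B=(P,V,E_1), where p ∈ P is adjacent to v ∈ V if and only if p = v or pv ∈ E, is an interval bigraph; (ii) G is NOT a probe interval graph with probes P and nonprobes N; but (iii) G IS a probe interval graph with probes {a,c,d} and nonprobes {b,e,f}. -/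
/-- The graph of Example 4 of the paper, on vertices `a = 0`, `b = 1`, `c = 2`,
`d = 3`, `e = 4`, `f = 5`, with edges `ab, bc, bd, cd, ce, df`. -/
def exampleGraph : SimpleGraph (Fin 6) :=
  SimpleGraph.fromRel (fun u v =>
    (u, v) ∈ ([(0, 1), (1, 2), (1, 3), (2, 3), (2, 4), (3, 5)] : List (Fin 6 × Fin 6)))

theorem Icc_inter_Icc_nonempty_iff {a b c d : ℝ} (hab : a ≤ b) (hcd : c ≤ d) :
    (Set.Icc a b ∩ Set.Icc c d).Nonempty ↔ a ≤ d ∧ c ≤ b := by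
  rw [Set.Icc_inter_Icc, Set.nonempty_Icc]
  simp [hab, hcd, and_comm]

theorem exampleGraph_adj_iff (u v : Fin 6) :
    exampleGraph.Adj u v ↔ u ≠ v ∧
      ((u, v) ∈ ([(0, 1), (1, 2), (1, 3), (2, 3), (2, 4), (3, 5)] : List (Fin 6 × Fin 6)) ∨
        (v, u) ∈ ([(0, 1), (1, 2), (1, 3), (2, 3), (2, 4), (3, 5)] : List (Fin 6 × Fin 6))) :=
  SimpleGraph.fromRel_adj _ _ _

theorem exampleGraph_isIntervalBigraph :
    IsIntervalBigraph
      (fun (p : ↥({0, 1, 2, 3} : Set (Fin 6))) (v : Fin 6) =>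
        (p : Fin 6) = v ∨ exampleGraph.Adj (p : Fin 6) v) := by
  have hX : ∀ x : Fin 6, (![3, 2, 0, -1, 0, 0] x : ℝ) ≤ ![3, 3, 0, -1, 0, 0] x := by
    intro x; fin_cases x <;> norm_num
  have hY : ∀ y : Fin 6, (![3, -1, -1, -1, 0, -1] y : ℝ) ≤ ![3, 3, 2, 2, 0, -1] y := by
    intro y; fin_cases y <;> norm_num
  refine ⟨fun x => ![3, 2, 0, -1, 0, 0] x.1, fun x => ![3, 3, 0, -1, 0, 0] x.1,
    ![3, -1, -1, -1, 0, -1], ![3, 3, 2, 2, 0, -1], fun x => hX x.1, hY, ?_⟩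
  rintro ⟨x, hx⟩ y
  change x = y ∨ exampleGraph.Adj x y ↔ _
  rw [Icc_inter_Icc_nonempty_iff (hX x) (hY y), exampleGraph_adj_iff]
  simp only [Set.mem_insert_iff, Set.mem_singleton_iff] at hx
  fin_cases x <;> fin_cases y <;> first | exact absurd hx (by decide) | (norm_num <;> decide)

theorem exampleGraph_not_isProbeIntervalGraph :
    ¬ IsProbeIntervalGraph exampleGraph ({0, 1, 2, 3} : Set (Fin 6)) ({4, 5} : Set (Fin 6)) := by
  rintro ⟨-, -, l, r, hlr, h⟩
  have adj : ∀ u v : Fin 6, exampleGraph.Adj u v → l u ≤ r v ∧ l v ≤ r u := fun u v huv =>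
    (Icc_inter_Icc_nonempty_iff (hlr u) (hlr v)).1 ((h u v huv.ne).1 huv).1
  have nonadj : ∀ u v : Fin 6, u ≠ v → u ∈ ({0, 1, 2, 3} : Set (Fin 6)) →
      ¬ exampleGraph.Adj u v → r v < l u ∨ r u < l v := by
    intro u v huv hu hn
    by_contra! hc
    exact hn ((h u v huv).2 ⟨(Icc_inter_Icc_nonempty_iff (hlr u) (hlr v)).2 hc, Or.inl hu⟩)
  obtain ⟨_, _⟩ := adj 0 1 (by simp [exampleGraph_adj_iff])
  obtain ⟨_, _⟩ := adj 1 2 (by simp [exampleGraph_adj_iff])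
  obtain ⟨_, _⟩ := adj 1 3 (by simp [exampleGraph_adj_iff])
  obtain ⟨_, _⟩ := adj 2 3 (by simp [exampleGraph_adj_iff])
  obtain ⟨_, _⟩ := adj 2 4 (by simp [exampleGraph_adj_iff])
  obtain ⟨_, _⟩ := adj 3 5 (by simp [exampleGraph_adj_iff])
  have h02 := nonadj 0 2 (by decide) (by simp) (by simp [exampleGraph_adj_iff])
  have h03 := nonadj 0 3 (by decide) (by simp) (by simp [exampleGraph_adj_iff])
  have h14 := nonadj 1 4 (by decide) (by simp) (by simp [exampleGraph_adj_iff])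
  have h15 := nonadj 1 5 (by decide) (by simp) (by simp [exampleGraph_adj_iff])
  have h25 := nonadj 2 5 (by decide) (by simp) (by simp [exampleGraph_adj_iff])
  have h34 := nonadj 3 4 (by decide) (by simp) (by simp [exampleGraph_adj_iff])
  have := hlr 0
  have := hlr 1
  have := hlr 2
  have := hlr 3
  have := hlr 4
  have := hlr 5
  rcases h02 with _ | _ <;> rcases h03 with _ | _ <;> try linarith
  all_goals rcases h14 with _ | _ <;> rcases h15 with _ | _ <;> try linarith
  all_goals rcases h25 with _ | _ <;> rcases h34 with _ | _ <;> linarith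

theorem exampleGraph_isProbeIntervalGraph :
    IsProbeIntervalGraph exampleGraph ({0, 2, 3} : Set (Fin 6)) ({1, 4, 5} : Set (Fin 6)) := by
  have hle : ∀ v : Fin 6, (![5, 2, 0, 2, 0, 4] v : ℝ) ≤ ![5, 5, 2, 4, 0, 4] v := by
    intro v; fin_cases v <;> norm_num
  refine ⟨?_, ?_, ![5, 2, 0, 2, 0, 4], ![5, 5, 2, 4, 0, 4], hle, ?_⟩
  · ext v; fin_cases v <;> simp
  · ext v; fin_cases v <;> simp
  · intro u v huv
    rw [Icc_inter_Icc_nonempty_iff (hle u) (hle v), exampleGraph_adj_iff]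
    fin_cases u <;> fin_cases v <;> first | exact absurd rfl huv | (norm_num <;> decide)

/-- For the graph `G` above with `P = {a,b,c,d}` and `N = {e,f}`:
(i) the bipartite graph `B = (P, V, E₁)` (where `p ∈ P` is adjacent to `v ∈ V` iff
`p = v` or `pv ∈ E`) is an interval bigraph; (ii) `G` is not a probe interval graph
with probes `P` and nonprobes `N`; but (iii) `G` is a probe interval graph with
probes `{a,c,d}` and nonprobes `{b,e,f}`. -/
theorem exampleGraph_necessary_not_sufficient :
    IsIntervalBigraph
      (fun (p : ↥({0, 1, 2, 3} : Set (Fin 6))) (v : Fin 6) =>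
        (p : Fin 6) = v ∨ exampleGraph.Adj (p : Fin 6) v) ∧
    ¬ IsProbeIntervalGraph exampleGraph ({0, 1, 2, 3} : Set (Fin 6)) ({4, 5} : Set (Fin 6)) ∧
    IsProbeIntervalGraph exampleGraph ({0, 2, 3} : Set (Fin 6)) ({1, 4, 5} : Set (Fin 6)) := by
  exact ⟨exampleGraph_isIntervalBigraph, exampleGraph_not_isProbeIntervalGraph,
    exampleGraph_isProbeIntervalGraph⟩
end

section
/- Let G=(V,E) be a finite simple graph with an independent set N ⊆ V and P = V∖N, and let B=(P,V,E_1) be the bipartite graph with partite sets P and a disjoint copy of V in which p ∈ P is adjacent to v ∈ V if and only if p = v or pv ∈ E. Then G is a probe interval graph with probes P and nonprobes N if and only if (1) B is an interval bigraph, and (2) there exist a linear ordering of the rows (indexed by P) and of the columns (indexed by V) of the biadjacency matrix of B together with an R-C partition of it (a labeling of the zero entries by R and C such that every entry to the right of an R in the same row is R and every entry below a C in the same column is C) which does not contain the following configuration: distinct p,q ∈ P with pq ∈ E and n ∈ N such that the entry in row p, column n is labeled R and the entry in row q, column n is labeled C. -/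
/-- A real-valued function on a finite type is weakly increasing along some injective
ranking of the type by natural numbers. -/
theorem exists_injective_nat_ranking {α : Type*} [Finite α] (f : α → ℝ) :
    ∃ σ : α → ℕ, Function.Injective σ ∧ ∀ x y, σ x < σ y → f x ≤ f y := by
  obtain ⟨n, ⟨e⟩⟩ := Finite.exists_equiv_fin α
  let s := Tuple.sort (f ∘ e.symm)
  refine ⟨fun x => (s.symm (e x) : ℕ),
    Fin.val_injective.comp (s.symm.injective.comp e.injective), fun x y h => ?_⟩
  have hm := Tuple.monotone_sort (f ∘ e.symm) (Fin.le_def.mpr h.le)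
  simpa [s] using hm

/-- A relation whose rows are upward closed in a linear order of the columns is a threshold
relation, and the thresholds of the columns may be taken monotone in the column sets. -/
theorem exists_nat_thresholds {P V : Type*} [Fintype P] [Fintype V] (R : P → V → Prop)
    (τ : V → ℕ) (hτ : Function.Injective τ)
    (hR : ∀ p v w, R p v → τ v < τ w → R p w) :
    ∃ (a : V → ℕ) (b : P → ℕ), (∀ p v, R p v ↔ b p < a v) ∧
      ∀ v w, (∀ p, R p v → R p w) → a v ≤ a w := by
  classical
  let S : V → Finset P := fun v => Finset.univ.filter fun p => R p v
  have hS : ∀ p v, p ∈ S v ↔ R p v := fun p v => by simp [S]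
  let b : P → ℕ := fun p => (Finset.univ.filter fun v => ¬ R p v).sup fun v => (S v).card
  refine ⟨fun v => (S v).card, b, fun p v => ⟨fun h => ?_, fun h => ?_⟩, fun v w h => ?_⟩
  · refine (Finset.sup_lt_iff (Finset.card_pos.mpr ⟨p, (hS p v).mpr h⟩)).mpr fun w hw => ?_
    have hw : ¬ R p w := by simpa using hw
    have hlt : τ w < τ v := by
      rcases lt_trichotomy (τ w) (τ v) with h' | h' | h'
      · exact h'
      · exact absurd (hτ h' ▸ h) hw
      · exact absurd (hR p v w h h') hw
    refine Finset.card_lt_card (Finset.ssubset_iff_of_subset (fun q hq => ?_) |>.mpr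
      ⟨p, (hS p v).mpr h, fun hp => hw ((hS p w).mp hp)⟩)
    exact (hS q v).mpr (hR q w v ((hS q w).mp hq) hlt)
  · by_contra hn
    refine absurd h (not_lt.mpr ?_)
    exact Finset.le_sup (f := fun v => (S v).card)
      (Finset.mem_filter.mpr ⟨Finset.mem_univ v, hn⟩)
  · exact Finset.card_le_card fun p hp => (hS p w).mpr (h p ((hS p v).mp hp))

/-- The bigraph `B = (P, V, E₁)` of a probe interval graph is an interval bigraph. -/
theorem IsProbeIntervalGraph.isIntervalBigraph {V : Type*} {G : SimpleGraph V} {P N : Set V}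
    (h : IsProbeIntervalGraph G P N) :
    IsIntervalBigraph fun (p : ↥P) (v : V) => (p : V) = v ∨ G.Adj (p : V) v := by
  obtain ⟨-, -, a, b, hab, hadj⟩ := h
  refine ⟨fun p => a p, fun p => b p, a, b, fun p => hab p, hab, fun p v => ?_⟩
  by_cases hpv : (p : V) = v
  · simp only [hpv, true_or, Set.inter_self, true_iff]
    exact Set.nonempty_Icc.mpr (hab v)
  · simp [hpv, hadj _ _ hpv, p.2]

/-- An R-C partition of the biadjacency matrix of the bigraph of a probe interval graph can be
read off from the intervals, without the forbidden configuration. -/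
theorem IsProbeIntervalGraph.exists_RC_partition {V : Type*} [Finite V] {G : SimpleGraph V}
    {P N : Set V} (h : IsProbeIntervalGraph G P N) :
    ∃ (σ : ↥P → ℕ) (τ : V → ℕ) (L : ↥P → V → RCEntry),
      Function.Injective σ ∧ Function.Injective τ ∧
      (∀ (p : ↥P) (v : V), L p v = RCEntry.one ↔ ((p : V) = v ∨ G.Adj (p : V) v)) ∧
      (∀ (p : ↥P) (v w : V), L p v = RCEntry.R → τ v < τ w → L p w = RCEntry.R) ∧
      (∀ (p q : ↥P) (v : V), L p v = RCEntry.C → σ p < σ q → L q v = RCEntry.C) ∧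
      ∀ (p q : ↥P) (v : V), G.Adj (p : V) (q : V) → L p v = RCEntry.R →
        L q v ≠ RCEntry.C := by
  classical
  obtain ⟨-, -, a, b, hab, hadj⟩ := h
  obtain ⟨σ, hσ, hσa⟩ := exists_injective_nat_ranking fun p : ↥P => a p
  obtain ⟨τ, hτ, hτa⟩ := exists_injective_nat_ranking a
  let L : ↥P → V → RCEntry := fun p v =>
    if b p < a v then RCEntry.R else if b v < a p then RCEntry.C else RCEntry.one
  have hLR : ∀ p v, L p v = RCEntry.R ↔ b p < a v := fun p v => by
    simp only [L]; split_ifs <;> simp_all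
  have hLC : ∀ p v, L p v = RCEntry.C ↔ b v < a p := fun p v => by
    have := hab p
    have := hab v
    simp only [L]
    split_ifs with h₁ h₂
    · simp only [false_iff]; linarith
    · simp [h₂]
    · simp [h₂]
  have hLone : ∀ p v, L p v = RCEntry.one ↔ a p ≤ b v ∧ a v ≤ b p := fun p v => by
    simp only [L]
    split_ifs with h₁ h₂
    · simp [h₁]
    · simp [h₂]
    · simp only [true_iff]; exact ⟨not_lt.mp h₂, not_lt.mp h₁⟩
  refine ⟨σ, τ, L, hσ, hτ, fun p v => ?_, fun p v w hv hvw => ?_, fun p q v hv hpq => ?_,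
    fun p q v hpq hp hq => ?_⟩
  · rw [hLone]
    by_cases hpv : (p : V) = v
    · simp [hpv, hab v]
    · rw [hadj _ _ hpv, Icc_inter_Icc_nonempty_iff (hab _) (hab _)]
      simp [hpv, p.2]
  · exact (hLR p w).mpr (((hLR p v).mp hv).trans_le (hτa v w hvw))
  · exact (hLC q v).mpr (((hLC p v).mp hv).trans_le (hσa p q hpq))
  · have hi := ((hadj _ _ hpq.ne).mp hpq).1
    rw [Icc_inter_Icc_nonempty_iff (hab _) (hab _)] at hi
    have := (hLR p v).mp hp
    have := (hLC q v).mp hq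
    linarith [hab v, hi.2]

/-- An R-C partition without the forbidden configuration yields a probe interval
representation. -/
theorem isProbeIntervalGraph_of_RC_partition {V : Type*} [Fintype V] (G : SimpleGraph V)
    (N : Set V) (hN : ∀ u ∈ N, ∀ v ∈ N, ¬ G.Adj u v)
    (σ : ↥(Nᶜ) → ℕ) (τ : V → ℕ) (L : ↥(Nᶜ) → V → RCEntry)
    (hσ : Function.Injective σ) (hτ : Function.Injective τ)
    (hone : ∀ (p : ↥(Nᶜ)) (v : V),
      L p v = RCEntry.one ↔ ((p : V) = v ∨ G.Adj (p : V) v))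
    (hR : ∀ (p : ↥(Nᶜ)) (v w : V), L p v = RCEntry.R → τ v < τ w → L p w = RCEntry.R)
    (hC : ∀ (p q : ↥(Nᶜ)) (v : V), L p v = RCEntry.C → σ p < σ q → L q v = RCEntry.C)
    (hgood : ∀ (p q : ↥(Nᶜ)), ∀ n ∈ N, G.Adj (p : V) (q : V) → L p n = RCEntry.R →
      L q n ≠ RCEntry.C) :
    IsProbeIntervalGraph G Nᶜ N := by
  classical
  have hdiag : ∀ p : ↥(Nᶜ), L p p = RCEntry.one := fun p => (hone p p).mpr (Or.inl rfl)
  have hsymm : ∀ p q : ↥(Nᶜ), L p q = RCEntry.one → L q p = RCEntry.one := fun p q h =>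
    (hone q p).mpr (((hone p q).mp h).imp Eq.symm SimpleGraph.Adj.symm)
  have τ_lt : ∀ (p : ↥(Nᶜ)) (v w : V), L p v = RCEntry.R → L p w ≠ RCEntry.R →
      τ w < τ v := fun p v w hv hw => by
    rcases lt_trichotomy (τ w) (τ v) with h | h | h
    · exact h
    · exact absurd (hτ h ▸ hv) hw
    · exact absurd (hR p v w hv h) hw
  have σ_lt : ∀ (p q : ↥(Nᶜ)) (v : V), L p v = RCEntry.C → L q v ≠ RCEntry.C →
      σ q < σ p := fun p q v hp hq => by
    rcases lt_trichotomy (σ q) (σ p) with h | h | h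
    · exact h
    · exact absurd (hσ h ▸ hp) hq
    · exact absurd (hC p q v hp h) hq
  have hRC : ∀ p q : ↥(Nᶜ), L p q = RCEntry.R → L q p = RCEntry.C := fun p q h => by
    cases h' : L q p with
    | one => simp [hsymm q p h'] at h
    | C => rfl
    | R =>
      have h₁ := τ_lt p q p h (by simp [hdiag])
      have h₂ := τ_lt q p q h' (by simp [hdiag])
      omega
  have hCR : ∀ p q : ↥(Nᶜ), L p q = RCEntry.C → L q p = RCEntry.R := fun p q h => by
    cases h' : L q p with
    | one => simp [hsymm q p h'] at h
    | R => rfl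
    | C =>
      have h₁ := σ_lt p q q h (by simp [hdiag])
      have h₂ := σ_lt q p p h' (by simp [hdiag])
      omega
  obtain ⟨a, b, hab, hmono⟩ :=
    exists_nat_thresholds (fun p v => L p v = RCEntry.R) τ hτ hR
  have a_le_of_nonprobe : ∀ (q : ↥(Nᶜ)), ∀ n ∈ N, L q n = RCEntry.C → a n ≤ a q := by
    refine fun q n hn hq => hmono n q fun p hp => ?_
    cases h : L p q with
    | R => rfl
    | one =>
      rcases (hone p q).mp h with h' | h'
      · rw [Subtype.ext h', hq] at hp
        cases hp
      · exact absurd hq (hgood p q n hn h' hp)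
    | C =>
      have h₁ := τ_lt q p n (hCR p q h) (by simp [hq])
      have h₂ := τ_lt p n p hp (by simp [hdiag])
      omega
  have a_le_of_lt : ∀ r q : ↥(Nᶜ), σ r < σ q → ∀ n, L r n = RCEntry.one →
      L q n = RCEntry.C → a r ≤ a q := fun r q hrq _ _ _ =>
    hmono r q fun p hp => hCR q p (hC r q p (hRC p r hp) hrq)
  let K : ℕ := Finset.univ.sup σ + 2
  have hK : ∀ p, σ p + 1 < K := fun p => by
    have : σ p ≤ Finset.univ.sup σ := Finset.le_sup (Finset.mem_univ p)
    simp only [K]; omega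
  let lo' : ↥(Nᶜ) → ℕ := fun p => K * a p + (σ p + 1)
  let s : V → Finset ↥(Nᶜ) := fun v => Finset.univ.filter fun r => L r v = RCEntry.one
  let lo : V → ℕ := fun v => if h : v ∈ N then K * a v else lo' ⟨v, h⟩
  let hi : V → ℕ := fun v =>
    if h : v ∈ N then max (K * a v) ((s v).sup lo') else K * b ⟨v, h⟩ + (K - 1)
  have lo_probe : ∀ p : ↥(Nᶜ), lo p = K * a p + (σ p + 1) := fun p => dif_neg p.2
  have hi_probe : ∀ p : ↥(Nᶜ), hi p = K * b p + (K - 1) := fun p => dif_neg p.2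
  have lo_nonprobe : ∀ n ∈ N, lo n = K * a n := fun n hn => dif_pos hn
  have hi_nonprobe : ∀ n ∈ N, hi n = max (K * a n) ((s n).sup lo') := fun n hn => dif_pos hn
  have scale : ∀ x y i j : ℕ, i < K → x < y → K * x + i < K * y + j := fun x y i j hi hxy => by
    have := Nat.mul_le_mul_left K (Nat.succ_le_of_lt hxy)
    rw [Nat.mul_succ] at this
    omega
  have hi_lt_lo : ∀ (p : ↥(Nᶜ)) (v : V), hi p < lo v ↔ L p v = RCEntry.R := fun p v => by
    have hKp := hK p
    rw [hab p v, hi_probe]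
    obtain ⟨i, hiK, hlo⟩ : ∃ i < K, lo v = K * a v + i := by
      by_cases hv : v ∈ N
      · exact ⟨0, by omega, lo_nonprobe v hv⟩
      · exact ⟨_, hK ⟨v, hv⟩, lo_probe ⟨v, hv⟩⟩
    rw [hlo]
    refine ⟨fun h => ?_, scale _ _ _ _ (by omega)⟩
    by_contra hn
    have := Nat.mul_le_mul_left K (not_lt.mp hn)
    omega
  have lo_le_hi : ∀ v, lo v ≤ hi v := fun v => by
    by_cases hv : v ∈ N
    · rw [lo_nonprobe v hv, hi_nonprobe v hv]
      exact le_max_left _ _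
    · refine not_lt.mp fun h => ?_
      have := (hi_lt_lo ⟨v, hv⟩ v).mp h
      simp [hdiag ⟨v, hv⟩] at this
  have probe_adj : ∀ (p : ↥(Nᶜ)) (v : V), (p : V) ≠ v →
      (G.Adj p v ↔ lo p ≤ hi v ∧ lo v ≤ hi p) := by
    intro p v hpv
    have hadj : G.Adj p v ↔ L p v = RCEntry.one := by simp [hone, hpv]
    rw [hadj, ← not_lt (a := hi p), hi_lt_lo, ← not_lt]
    by_cases hv : v ∈ N
    · rw [hi_nonprobe v hv]
      cases h : L p v with
      | R => simp
      | one =>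
        simp only [reduceCtorEq, not_false_eq_true, and_true, true_iff, not_lt]
        refine le_max_of_le_right ?_
        rw [lo_probe]
        exact Finset.le_sup (f := lo') (Finset.mem_filter.mpr ⟨Finset.mem_univ p, h⟩)
      | C =>
        simp only [reduceCtorEq, not_false_eq_true, and_true, false_iff, not_not]
        rw [lo_probe]
        have h₁ := Nat.mul_le_mul_left K (a_le_of_nonprobe p v hv h)
        refine max_lt (by omega) ((Finset.sup_lt_iff (by simp)).mpr fun r hr => ?_)
        have hr : L r v = RCEntry.one := by simpa [s] using hr
        have hlt := σ_lt p r v h (by simp [hr])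
        have h₂ := Nat.mul_le_mul_left K (a_le_of_lt r p hlt v hr h)
        simp only [lo']
        omega
    · have hvp := hi_lt_lo ⟨v, hv⟩ p
      have hsymm_v := hsymm p ⟨v, hv⟩
      have hCR_v := hCR p ⟨v, hv⟩
      simp only at hvp hsymm_v hCR_v
      rw [hvp]
      cases h : L p v with
      | one => simp [hsymm_v h]
      | R => simp
      | C => simp [hCR_v h]
  refine ⟨Set.compl_union_self N, Set.compl_inter_self N, fun v => lo v, fun v => hi v,
    fun v => Nat.cast_le.mpr (lo_le_hi v), fun u v huv => ?_⟩
  rw [Icc_inter_Icc_nonempty_iff (Nat.cast_le.mpr (lo_le_hi u))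
    (Nat.cast_le.mpr (lo_le_hi v))]
  simp only [Nat.cast_le]
  by_cases hu : u ∈ N
  · by_cases hv : v ∈ N
    · simp [hu, hv, hN u hu v hv]
    · rw [G.adj_comm, probe_adj ⟨v, hv⟩ u huv.symm]
      simp [hv, and_comm]
  · rw [probe_adj ⟨u, hu⟩ v huv]
    simp [hu]

/-- `G` with independent set `N` and `P = V ∖ N` is a probe interval graph
with probes `P` and nonprobes `N` iff (1) the bigraph `B = (P, V, E₁)` is an interval
bigraph, and (2) there are orderings of the rows (indexed by `P`, via an injection `σ`
into `ℕ`) and of the columns (indexed by `V`, via an injection `τ` into `ℕ`) of the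
biadjacency matrix of `B` and an R-C partition of it (a labeling `L` of its zero
entries by `R` and `C` with every entry right of an `R` being `R` and every entry below
a `C` being `C`) containing no configuration of distinct adjacent `p, q ∈ P` and
`n ∈ N` with `L p n = R` and `L q n = C`. -/
theorem probeIntervalGraph_iff_intervalBigraph_and_good_RC_partition
    {V : Type*} [Fintype V] (G : SimpleGraph V) (N : Set V)
    (hN : ∀ u ∈ N, ∀ v ∈ N, ¬ G.Adj u v) :
    IsProbeIntervalGraph G Nᶜ N ↔
      (IsIntervalBigraph
          (fun (p : ↥(Nᶜ)) (v : V) => (p : V) = v ∨ G.Adj (p : V) v) ∧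
        ∃ (σ : ↥(Nᶜ) → ℕ) (τ : V → ℕ) (L : ↥(Nᶜ) → V → RCEntry),
          Function.Injective σ ∧ Function.Injective τ ∧
          (∀ (p : ↥(Nᶜ)) (v : V),
            L p v = RCEntry.one ↔ ((p : V) = v ∨ G.Adj (p : V) v)) ∧
          (∀ (p : ↥(Nᶜ)) (v w : V), L p v = RCEntry.R → τ v < τ w → L p w = RCEntry.R) ∧
          (∀ (p q : ↥(Nᶜ)) (v : V), L p v = RCEntry.C → σ p < σ q → L q v = RCEntry.C) ∧
          ¬ ∃ (p q : ↥(Nᶜ)) (n : V), p ≠ q ∧ G.Adj (p : V) (q : V) ∧ n ∈ N ∧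
              L p n = RCEntry.R ∧ L q n = RCEntry.C) := by
  refine ⟨fun h => ⟨h.isIntervalBigraph, ?_⟩, ?_⟩
  · obtain ⟨σ, τ, L, hσ, hτ, hone, hR, hC, hgood⟩ := h.exists_RC_partition
    exact ⟨σ, τ, L, hσ, hτ, hone, hR, hC,
      fun ⟨p, q, n, _, hpq, _, hp, hq⟩ => hgood p q n hpq hp hq⟩
  · rintro ⟨-, σ, τ, L, hσ, hτ, hone, hR, hC, hgood⟩
    exact isProbeIntervalGraph_of_RC_partition G N hN σ τ L hσ hτ hone hR hC
      fun p q n hn hpq hp hq =>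
        hgood ⟨p, q, n, fun h => hpq.ne (congrArg Subtype.val h), hpq, hn, hp, hq⟩
end

section
/- Suppose the biadjacency matrix of the bipartite graph B=(P,V,E_1) associated to a graph G=(V,E) with independent set N = V∖P admits row and column orderings and an R-C partition containing no configuration of distinct p,q ∈ P with pq ∈ E and n ∈ N whose entries (p,n),(q,n) are labeled R and C respectively. Then there exist row and column orderings with the SAME labeling of each zero entry by R or C, still forming an R-C partition with no such forbidden configuration, in which the columns indexed by elements of P occur in the same relative order as the corresponding rows. -/
/-- In an R-C partition of a matrix whose `P × P` part has symmetric ones and ones on the diagonal,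
the `R` labels in columns indexed by `P` propagate along the row order. -/
theorem R_of_row_lt {V : Type*} {P : Set V} {σ : ↥P → ℕ} {τ : V → ℕ} {L : ↥P → V → RCEntry}
    (hτ : Function.Injective τ)
    (hdiag : ∀ p : ↥P, L p p = RCEntry.one)
    (hsymm : ∀ p q : ↥P, L p q = RCEntry.one → L q p = RCEntry.one)
    (hR : ∀ (p : ↥P) (v w : V), L p v = RCEntry.R → τ v < τ w → L p w = RCEntry.R)
    (hC : ∀ (p q : ↥P) (v : V), L p v = RCEntry.C → σ p < σ q → L q v = RCEntry.C)
    (hσ : Function.Injective σ) {p q r : ↥P} (hpq : σ p < σ q) (hrp : L r p = RCEntry.R) :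
    L r q = RCEntry.R := by
  by_contra hrq
  have hτrp : τ r < τ p := by
    rcases lt_trichotomy (τ r) (τ p) with h | h | h
    · exact h
    · have := hdiag r
      rw [hτ h, hrp] at this
      cases this
    · have := hR r p r hrp h
      rw [hdiag] at this
      cases this
  have hpr : L p r = RCEntry.C := by
    cases h : L p r with
    | one => simp [hsymm p r h] at hrp
    | R => simpa [hdiag] using hR p r p h hτrp
    | C => rfl
  have hqr : L q r = RCEntry.C := hC p q r hpr hpq
  have hrqC : L r q = RCEntry.C := by
    cases h : L r q with
    | one => simp [hsymm r q h] at hqr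
    | R => exact absurd h hrq
    | C => rfl
  rcases lt_trichotomy (σ r) (σ q) with h | h | h
  · simpa [hdiag] using hC r q q hrqC h
  · rw [hσ h, hdiag] at hqr
    cases hqr
  · simpa [hdiag] using hC q r r hqr h

/-- The lexicographic order of two `ℕ`-valued keys on a finite type, the second one injective,
is realised by a single injective `ℕ`-valued key. -/
theorem exists_injective_lex_key {V : Type*} [Finite V] (b s : V → ℕ)
    (hs : Function.Injective s) :
    ∃ t : V → ℕ, Function.Injective t ∧ ∀ v w, t v < t w ↔ b v < b w ∨ b v = b w ∧ s v < s w := by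
  obtain ⟨M, hM⟩ := (Set.finite_range s).bddAbove
  have hsM (v : V) : s v < M + 1 := Nat.lt_succ_of_le (hM ⟨v, rfl⟩)
  have of_lt {v w : V} (h : b v < b w) : b v * (M + 1) + s v < b w * (M + 1) + s w := by
    nlinarith [hsM v, Nat.mul_le_mul_right (M + 1) (Nat.succ_le_of_lt h)]
  refine ⟨fun v => b v * (M + 1) + s v, fun v w h => hs ?_, fun v w => ?_⟩
  · rcases lt_trichotomy (b v) (b w) with hb | hb | hb
    · exact absurd h (of_lt hb).ne
    · simpa [hb] using h
    · exact absurd h (of_lt hb).ne'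
  · rcases lt_trichotomy (b v) (b w) with hb | hb | hb
    · simpa [hb] using of_lt hb
    · simp [hb]
    · simpa [hb.not_gt, hb.ne'] using (of_lt hb).le

/-- Suppose the biadjacency matrix of the bigraph `B = (P, V, E₁)` of a
graph `G` with independent set `N = V ∖ P` admits row and column orderings (injections
`σ : P → ℕ` and `τ : V → ℕ`) and an R-C partition (a labeling `L` of the zero entries
by `R` and `C`, every entry right of an `R` being `R` and every entry below a `C` being
`C`) with no forbidden configuration of distinct adjacent `p, q ∈ P` and `n ∈ N` with
`L p n = R` and `L q n = C`.  Then there are row and column orderings with the SAME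
labeling `L`, still an R-C partition with no forbidden configuration, in which the
columns indexed by elements of `P` occur in the same relative order as the
corresponding rows. -/
theorem exists_RC_partition_with_matching_probe_order
    {V : Type*} [Fintype V] (G : SimpleGraph V) (P : Set V)
    (hN : ∀ u ∈ Pᶜ, ∀ v ∈ Pᶜ, ¬ G.Adj u v)
    (σ : ↥P → ℕ) (τ : V → ℕ) (L : ↥P → V → RCEntry)
    (hσ : Function.Injective σ) (hτ : Function.Injective τ)
    (hL : ∀ (p : ↥P) (v : V), L p v = RCEntry.one ↔ ((p : V) = v ∨ G.Adj (p : V) v))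
    (hR : ∀ (p : ↥P) (v w : V), L p v = RCEntry.R → τ v < τ w → L p w = RCEntry.R)
    (hC : ∀ (p q : ↥P) (v : V), L p v = RCEntry.C → σ p < σ q → L q v = RCEntry.C)
    (hforb : ¬ ∃ (p q : ↥P) (n : V), p ≠ q ∧ G.Adj (p : V) (q : V) ∧ n ∈ Pᶜ ∧
        L p n = RCEntry.R ∧ L q n = RCEntry.C) :
    ∃ (σ' : ↥P → ℕ) (τ' : V → ℕ),
      Function.Injective σ' ∧ Function.Injective τ' ∧
      (∀ (p : ↥P) (v w : V), L p v = RCEntry.R → τ' v < τ' w → L p w = RCEntry.R) ∧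
      (∀ (p q : ↥P) (v : V), L p v = RCEntry.C → σ' p < σ' q → L q v = RCEntry.C) ∧
      (¬ ∃ (p q : ↥P) (n : V), p ≠ q ∧ G.Adj (p : V) (q : V) ∧ n ∈ Pᶜ ∧
          L p n = RCEntry.R ∧ L q n = RCEntry.C) ∧
      (∀ p q : ↥P, σ' p < σ' q ↔ τ' (p : V) < τ' (q : V)) := by
  classical
  have hdiag (p : ↥P) : L p p = RCEntry.one := (hL p p).2 (Or.inl rfl)
  have hsymm (p q : ↥P) (h : L p q = RCEntry.one) : L q p = RCEntry.one :=
    (hL q p).2 (((hL p q).1 h).imp Eq.symm SimpleGraph.Adj.symm)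
  let b : V → ℕ := fun v => {p : ↥P | L p v = RCEntry.R}.ncard
  let s : V → ℕ := fun v => if h : v ∈ P then 2 * σ ⟨v, h⟩ else 2 * τ v + 1
  have hs : Function.Injective s := by
    intro v w h
    by_cases hv : v ∈ P <;> by_cases hw : w ∈ P <;>
      simp only [s, hv, hw, dite_true, dite_false] at h
    · exact congrArg Subtype.val (hσ (by omega : σ ⟨v, hv⟩ = σ ⟨w, hw⟩))
    · omega
    · omega
    · exact hτ (by omega)
  have hsP (p : ↥P) : s p = 2 * σ p := by simp [s]
  obtain ⟨t, ht, htlt⟩ := exists_injective_lex_key b s hs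
  have hmono {p q : ↥P} (h : σ p < σ q) : t p < t q := by
    have hb : b p ≤ b q :=
      Set.ncard_le_ncard (fun r hr => R_of_row_lt hτ hdiag hsymm hR hC hσ h hr) (Set.toFinite _)
    rw [htlt, hsP, hsP]
    omega
  refine ⟨σ, t, hσ, ht, fun p v w hpv hvw => ?_, hC, hforb, fun p q => ⟨hmono, fun h => ?_⟩⟩
  · have hb : b v ≤ b w := by
      rw [htlt] at hvw
      omega
    rcases lt_trichotomy (τ v) (τ w) with h | h | h
    · exact hR p v w hpv h
    · exact hτ h ▸ hpv
    · have hsub : {p : ↥P | L p w = RCEntry.R} ⊆ {p : ↥P | L p v = RCEntry.R} :=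
        fun r hr => hR r w v hr h
      have heq := Set.eq_of_subset_of_ncard_le hsub hb (Set.toFinite _)
      exact heq.ge hpv
  · rcases lt_trichotomy (σ p) (σ q) with h' | h' | h'
    · exact h'
    · exact absurd h (by rw [hσ h']; exact lt_irrefl _)
    · exact absurd h (hmono h').not_gt
end

section
/- Let G=(V,E) be a probe interval graph with probes P and nonprobes N. Then the relation R on V defined by u R v iff uv ∈ E or (u=v and u ∈ P) (i.e., the adjacency relation of the graph Ĝ obtained from G by adding a loop at every probe vertex) is the intersection of three Ferrers relations on V×V; that is, the bipartite graph whose biadjacency matrix is the adjacency matrix of Ĝ has Ferrers dimension at most 3. -/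
/-- A relation `F : X → Y → Prop` is a Ferrers relation if the neighborhoods
`n(x) = {y | F x y}` are linearly ordered by inclusion; equivalently, there is no
`2 × 2` permutation submatrix. -/
def IsFerrers {X Y : Type*} (F : X → Y → Prop) : Prop :=
  ∀ (x x' : X) (y y' : Y), F x y → F x' y' → F x y' ∨ F x' y

/-- If `G` is a probe interval graph with probes `P` and nonprobes `N`,
then the adjacency relation of the graph `Ĝ`, obtained from `G` by adding a loop at
every probe vertex (`u R v` iff `uv ∈ E` or `u = v ∧ u ∈ P`), is the intersection of
three Ferrers relations on `V × V`; i.e. the corresponding bipartite graph has Ferrers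
dimension at most `3`. -/
theorem probeIntervalGraph_loops_ferrersDimension_le_three
    {V : Type*} [Fintype V] (G : SimpleGraph V) (P N : Set V)
    (h : IsProbeIntervalGraph G P N) :
    ∃ F₁ F₂ F₃ : V → V → Prop, IsFerrers F₁ ∧ IsFerrers F₂ ∧ IsFerrers F₃ ∧
      ∀ u v : V, (G.Adj u v ∨ (u = v ∧ u ∈ P)) ↔ (F₁ u v ∧ F₂ u v ∧ F₃ u v) := by
  obtain ⟨-, -, a, b, hab, hadj⟩ := h
  refine ⟨fun u v => a u ≤ b v, fun u v => a v ≤ b u, fun u v => u ∈ P ∨ v ∈ P,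
    fun x x' y y' h₁ h₂ => ?_, fun x x' y y' h₁ h₂ => ?_, fun x x' y y' h₁ _ => ?_,
    fun u v => ?_⟩
  · by_contra! hc
    linarith [hc.1, hc.2]
  · by_contra! hc
    linarith [hc.1, hc.2]
  · exact h₁.imp Or.inl Or.inr
  · by_cases huv : u = v
    · subst huv
      simp [hab u]
    · rw [hadj u v huv, Set.Icc_inter_Icc, Set.nonempty_Icc, sup_le_iff, le_inf_iff, le_inf_iff]
      simp [huv, hab u, hab v, and_assoc]
end

section
/- Let V be a finite linearly ordered set and let M be a symmetric V×V (0,1)-matrix with all diagonal entries equal to 1 satisfying the quasi-linear ones property (in each row, the 1 entries on or to the right of the diagonal are consecutive starting at the diagonal, and in each column, the 1 entries on or below the diagonal are consecutive starting at the diagonal). Then the relation F_1 = {(u,v) : u < v and M_{uv}=0} and the relation F_2 = {(u,v) : u > v and M_{uv}=0} are each Ferrers relations on V×V, and their union is the set of all zero positions of M. -/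
/-- If `M` is a symmetric `(0,1)`-matrix on a finite linearly ordered set
`V` with all diagonal entries `1` and the quasi-linear ones property (in each row the
`1`'s on or right of the diagonal are consecutive starting at the diagonal, and in each
column the `1`'s on or below the diagonal are consecutive starting at the diagonal),
then the zeros strictly above the diagonal and the zeros strictly below the diagonal
form two Ferrers relations whose union is the set of all zero positions of `M`. -/
theorem quasiLinearOnes_zeros_split_into_two_ferrers
    {V : Type*} [Fintype V] [LinearOrder V] (M : V → V → Bool)
    (hsym : ∀ u v : V, M u v = M v u)
    (hdiag : ∀ u : V, M u u = true)
    (hrow : ∀ u v w : V, u ≤ v → v ≤ w → M u w = true → M u v = true)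
    (hcol : ∀ u v w : V, v ≤ u → u ≤ w → M w v = true → M u v = true) :
    IsFerrers (fun u v : V => u < v ∧ M u v = false) ∧
    IsFerrers (fun u v : V => v < u ∧ M u v = false) ∧
    ∀ u v : V,
      ((u < v ∧ M u v = false) ∨ (v < u ∧ M u v = false)) ↔ M u v = false := by
  refine ⟨?_, ?_, ?_⟩
  · rintro u u' v v' ⟨huv, h⟩ ⟨huv', h'⟩
    rcases le_total v v' with hv | hv
    · exact Or.inl ⟨huv.trans_le hv, Bool.eq_false_iff.2 fun ht =>
        Bool.eq_false_iff.1 h (hrow u v v' huv.le hv ht)⟩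
    · exact Or.inr ⟨huv'.trans_le hv, Bool.eq_false_iff.2 fun ht =>
        Bool.eq_false_iff.1 h' (hrow u' v' v huv'.le hv ht)⟩
  · rintro u u' v v' ⟨hvu, h⟩ ⟨hvu', h'⟩
    rcases le_total u u' with hu | hu
    · exact Or.inr ⟨hvu.trans_le hu, Bool.eq_false_iff.2 fun ht =>
        Bool.eq_false_iff.1 h (hcol u v u' hvu.le hu ht)⟩
    · exact Or.inl ⟨hvu'.trans_le hu, Bool.eq_false_iff.2 fun ht =>
        Bool.eq_false_iff.1 h' (hcol u' v' u hvu'.le hu ht)⟩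
  · intro u v
    refine ⟨fun h => h.elim And.right And.right, fun h => ?_⟩
    rcases lt_trichotomy u v with huv | rfl | hvu
    · exact Or.inl ⟨huv, h⟩
    · exact absurd (hdiag u) (Bool.eq_false_iff.1 h)
    · exact Or.inr ⟨hvu, h⟩
end

section
/- The complete tripartite graph K_{2,2,2} (six vertices partitioned into three pairs, with two vertices adjacent iff they lie in different pairs) is an interval 3-graph but is not an interval split graph. In particular, for each of its three maximal independent sets (which are exactly the three pairs), the subgraph induced by the remaining four vertices is a 4-cycle, which is not an interval graph. -/
/-- A finite simple graph is an interval graph if each vertex can be assigned a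
nonempty closed real interval such that two distinct vertices are adjacent iff
their intervals intersect. -/
def IsIntervalGraph {V : Type*} (G : SimpleGraph V) : Prop :=
  ∃ a b : V → ℝ, (∀ v, a v ≤ b v) ∧
    ∀ u v : V, u ≠ v →
      (G.Adj u v ↔ (Set.Icc (a u) (b u) ∩ Set.Icc (a v) (b v)).Nonempty)

/-- A finite simple graph is an interval `k`-graph if there are a proper coloring by
`k` colors and an assignment of a nonempty closed real interval to each vertex such
that two distinct vertices are adjacent iff their intervals intersect and they
receive different colors. -/
def IsIntervalKGraph {V : Type*} (G : SimpleGraph V) (k : ℕ) : Prop :=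
  ∃ (c : V → Fin k) (a b : V → ℝ), (∀ v, a v ≤ b v) ∧
    ∀ u v : V, u ≠ v →
      (G.Adj u v ↔
        ((Set.Icc (a u) (b u) ∩ Set.Icc (a v) (b v)).Nonempty ∧ c u ≠ c v))

/-- A finite simple graph is an interval split graph if its vertex set can be
partitioned into a set inducing an interval graph and an independent set. -/
def IsIntervalSplitGraph {V : Type*} (G : SimpleGraph V) : Prop :=
  ∃ U₁ U₂ : Set V, U₁ ∪ U₂ = Set.univ ∧ U₁ ∩ U₂ = ∅ ∧
    IsIntervalGraph (G.induce U₁) ∧ ∀ u ∈ U₂, ∀ v ∈ U₂, ¬ G.Adj u v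

/-- The complete tripartite graph `K_{2,2,2}` on `Fin 6`, with parts
`{0,1}, {2,3}, {4,5}`: two vertices are adjacent iff they lie in different parts. -/
def K222 : SimpleGraph (Fin 6) :=
  SimpleGraph.fromRel (fun u v => u.val / 2 ≠ v.val / 2)

theorem not_isIntervalGraph_of_cycleGraph_four_embedding {V : Type*} {G : SimpleGraph V}
    (f : SimpleGraph.cycleGraph 4 ↪g G) : ¬ IsIntervalGraph G := by
  rintro ⟨a, b, hab, h⟩
  have inter (i j : Fin 4) (hij : i ≠ j) : (SimpleGraph.cycleGraph 4).Adj i j ↔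
      a (f i) ≤ b (f j) ∧ a (f j) ≤ b (f i) := by
    have hi := hab (f i)
    have hj := hab (f j)
    rw [← f.map_adj_iff, h _ _ (f.injective.ne hij), Set.Icc_inter_Icc, Set.nonempty_Icc]
    simp only [max_le_iff, le_min_iff]
    tauto
  have h01 := (inter 0 1 (by decide)).1 (by decide)
  have h12 := (inter 1 2 (by decide)).1 (by decide)
  have h23 := (inter 2 3 (by decide)).1 (by decide)
  have h30 := (inter 3 0 (by decide)).1 (by decide)
  have h02 := mt (inter 0 2 (by decide)).2 (by decide)
  have h13 := mt (inter 1 3 (by decide)).2 (by decide)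
  grind

theorem K222_adj_iff {u v : Fin 6} : K222.Adj u v ↔ u.val / 2 ≠ v.val / 2 := by
  simp only [K222, SimpleGraph.fromRel_adj]
  grind

theorem exists_part_of_K222_independent {S : Set (Fin 6)}
    (hS : ∀ u ∈ S, ∀ v ∈ S, ¬ K222.Adj u v) :
    S ⊆ {0, 1} ∨ S ⊆ {2, 3} ∨ S ⊆ {4, 5} := by
  rcases S.eq_empty_or_nonempty with rfl | ⟨u, hu⟩
  · simp
  have key : ∀ u : Fin 6,
      (∀ v : Fin 6, u.val / 2 = v.val / 2 → v = 0 ∨ v = 1) ∨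
      (∀ v : Fin 6, u.val / 2 = v.val / 2 → v = 2 ∨ v = 3) ∨
      (∀ v : Fin 6, u.val / 2 = v.val / 2 → v = 4 ∨ v = 5) := by decide
  have hSu : ∀ v ∈ S, u.val / 2 = v.val / 2 := fun v hv => by
    simpa [K222_adj_iff] using hS u hu v hv
  exact (key u).imp (fun k v hv => k v (hSu v hv))
    (Or.imp (fun k v hv => k v (hSu v hv)) (fun k v hv => k v (hSu v hv)))

theorem K222_part_maximal_independent {N : Set (Fin 6)}
    (hN : N = {0, 1} ∨ N = {2, 3} ∨ N = {4, 5}) :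
    (∀ u ∈ N, ∀ v ∈ N, ¬ K222.Adj u v) ∧
      ∀ N' : Set (Fin 6), (∀ u ∈ N', ∀ v ∈ N', ¬ K222.Adj u v) → N ⊆ N' → N' = N := by
  constructor
  · rcases hN with rfl | rfl | rfl <;> simp [K222_adj_iff]
  · intro N' hN' hsub
    refine Set.Subset.antisymm ?_ hsub
    rcases exists_part_of_K222_independent hN' with h | h | h <;>
      have h' := hsub.trans h <;>
      rcases hN with rfl | rfl | rfl <;>
      first
      | exact h
      | simp [Set.insert_subset_iff] at h'

theorem nonempty_induce_compl_part_iso {N : Set (Fin 6)}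
    (hN : N = {0, 1} ∨ N = {2, 3} ∨ N = {4, 5}) :
    Nonempty (K222.induce Nᶜ ≃g SimpleGraph.cycleGraph 4) := by
  have iso (f : Fin 4 → Fin 6) (hf : Function.Injective f) (hr : ∀ v, v ∈ Nᶜ ↔ ∃ i, f i = v)
      (hadj : ∀ i j, (f i).val / 2 ≠ (f j).val / 2 ↔ (SimpleGraph.cycleGraph 4).Adj i j) :
      Nonempty (K222.induce Nᶜ ≃g SimpleGraph.cycleGraph 4) := by
    let e : Fin 4 ≃ (Nᶜ : Set (Fin 6)) :=
      Equiv.ofBijective (fun i => ⟨f i, (hr _).2 ⟨i, rfl⟩⟩)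
        ⟨fun i j hij => hf (congrArg Subtype.val hij),
          fun v => ((hr v).1 v.2).imp fun _ hi => Subtype.ext hi⟩
    have he : ∀ {i j}, (K222.induce Nᶜ).Adj (e i) (e j) ↔
        (SimpleGraph.cycleGraph 4).Adj i j := fun {i j} => K222_adj_iff.trans (hadj i j)
    exact ⟨SimpleGraph.Iso.symm ⟨e, he⟩⟩
  rcases hN with rfl | rfl | rfl
  · refine iso ![2, 4, 3, 5] (by decide) ?_ (by decide)
    simp only [Set.mem_compl_iff, Set.mem_insert_iff, Set.mem_singleton_iff]
    decide
  · refine iso ![0, 4, 1, 5] (by decide) ?_ (by decide)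
    simp only [Set.mem_compl_iff, Set.mem_insert_iff, Set.mem_singleton_iff]
    decide
  · refine iso ![0, 2, 1, 3] (by decide) ?_ (by decide)
    simp only [Set.mem_compl_iff, Set.mem_insert_iff, Set.mem_singleton_iff]
    decide

theorem not_isIntervalGraph_induce_of_compl_part_subset {N U : Set (Fin 6)}
    (hN : N = {0, 1} ∨ N = {2, 3} ∨ N = {4, 5}) (hU : Nᶜ ⊆ U) :
    ¬ IsIntervalGraph (K222.induce U) := by
  obtain ⟨e⟩ := nonempty_induce_compl_part_iso hN
  exact not_isIntervalGraph_of_cycleGraph_four_embedding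
    ((K222.induceHomOfLE hU).comp e.symm.toEmbedding)

theorem isIntervalKGraph_K222 : IsIntervalKGraph K222 3 := by
  refine ⟨fun v => ⟨v.val / 2, by omega⟩, fun _ => 0, fun _ => 0, fun _ => le_rfl, ?_⟩
  intro u v _
  simp [K222_adj_iff]

theorem not_isIntervalSplitGraph_K222 : ¬ IsIntervalSplitGraph K222 := by
  rintro ⟨U₁, U₂, hunion, -, hint, hind⟩
  have part {N : Set (Fin 6)} (hN : N = {0, 1} ∨ N = {2, 3} ∨ N = {4, 5}) (h : U₂ ⊆ N) :
      False := by
    refine not_isIntervalGraph_induce_of_compl_part_subset hN (fun v hv => ?_) hint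
    have hv' : v ∈ U₁ ∪ U₂ := hunion ▸ Set.mem_univ v
    exact hv'.resolve_right fun hv₂ => hv (h hv₂)
  rcases exists_part_of_K222_independent hind with h | h | h
  · exact part (by simp) h
  · exact part (by simp) h
  · exact part (by simp) h

/-- `K_{2,2,2}` is an interval `3`-graph but not an interval split graph.
Its maximal independent sets are exactly the three parts `{0,1}, {2,3}, {4,5}`, and for
each of them the subgraph induced by the remaining four vertices is a `4`-cycle, which
is not an interval graph. -/
theorem K222_interval3Graph_not_intervalSplitGraph :
    IsIntervalKGraph K222 3 ∧
    ¬ IsIntervalSplitGraph K222 ∧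
    (∀ N : Set (Fin 6),
      ((∀ u ∈ N, ∀ v ∈ N, ¬ K222.Adj u v) ∧
        ∀ N' : Set (Fin 6), (∀ u ∈ N', ∀ v ∈ N', ¬ K222.Adj u v) → N ⊆ N' → N' = N) ↔
      (N = {0, 1} ∨ N = {2, 3} ∨ N = {4, 5})) ∧
    (∀ N : Set (Fin 6), (N = {0, 1} ∨ N = {2, 3} ∨ N = {4, 5}) →
      Nonempty (K222.induce Nᶜ ≃g SimpleGraph.cycleGraph 4) ∧
      ¬ IsIntervalGraph (K222.induce Nᶜ)) := by
  refine ⟨isIntervalKGraph_K222, not_isIntervalSplitGraph_K222, fun N => ⟨?_, ?_⟩, fun N hN =>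
    ⟨nonempty_induce_compl_part_iso hN,
      not_isIntervalGraph_induce_of_compl_part_subset hN subset_rfl⟩⟩
  · rintro ⟨hind, hmax⟩
    have eq_part {P : Set (Fin 6)} (hP : P = {0, 1} ∨ P = {2, 3} ∨ P = {4, 5}) (h : N ⊆ P) :
        N = P := (hmax P (K222_part_maximal_independent hP).1 h).symm
    exact (exists_part_of_K222_independent hind).imp (eq_part (by simp))
      (Or.imp (eq_part (by simp)) (eq_part (by simp)))
  · exact K222_part_maximal_independent
end
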